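/- For any δ > 0, with probability at least 1 − δ over the draw of the samples S_1, …, S_N, simultaneously for every h ∈ H: |ε_α(h) − ε̂_α(h)| ≤ 2 Σ_{i=1}^N α_i R_i(H) + 3 √(log(4/δ) M² / 2) · √(Σ_{i=1}^N α_i² / m_i). (Proposition 1 of the paper.) -/

import Mathlib

open MeasureTheory

noncomputable section

/-- A Rademacher sign encoded by a Boolean. -/
def radSign (b : Bool) : ℝ := if b then 1 else -1

variable {X Y : Type*} [MeasurableSpace X] [MeasurableSpace Y]

/-- Expected risk of a predictor `f` under a distribution `P` on `X × Y`. -/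
def expRisk (L : Y → Y → ℝ) (P : Measure (X × Y)) (f : X → Y) : ℝ :=
  ∫ z, L (f z.1) z.2 ∂P

/-- The α-weighted empirical risk of `f` on the samples `S`. -/
def empRisk {N : ℕ} (L : Y → Y → ℝ) (m : Fin N → ℕ) (α : Fin N → ℝ)
    (S : (i : Fin N) → Fin (m i) → X × Y) (f : X → Y) : ℝ :=
  ∑ i, (α i / (m i : ℝ)) * ∑ j, L (f (S i j).1) (S i j).2

/-- Joint distribution of the samples: for each source `i`, `m i` i.i.d. draws from `D i`,
all sources mutually independent. -/
def sampleMeasure {N : ℕ} (m : Fin N → ℕ) (D : Fin N → Measure (X × Y)) :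
    Measure ((i : Fin N) → Fin (m i) → X × Y) :=
  Measure.pi fun i => Measure.pi fun _ => D i

/-- Joint distribution of the i.i.d. Rademacher signs (encoded as Booleans). -/
def radMeasure (N : ℕ) (m : Fin N → ℕ) : Measure ((i : Fin N) → Fin (m i) → Bool) :=
  Measure.pi fun _ => Measure.pi fun _ => (PMF.uniformOfFintype Bool).toMeasure

/-- Data-dependent Rademacher complexity of source `i`. -/
def radComplexity {ι : Type*} {N : ℕ} (L : Y → Y → ℝ) (h : ι → X → Y) (m : Fin N → ℕ)
    (S : (i : Fin N) → Fin (m i) → X × Y) (i : Fin N) : ℝ :=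
  ∫ σ, (⨆ k, (1 / (m i : ℝ)) * ∑ j, radSign (σ i j) * L (h k (S i j).1) (S i j).2)
    ∂(radMeasure N m)

/-- Discrepancy between two distributions with respect to the hypothesis class `h`. -/
def discrepancy {ι : Type*} (L : Y → Y → ℝ) (h : ι → X → Y) (P Q : Measure (X × Y)) : ℝ :=
  ⨆ k, |expRisk L P (h k) - expRisk L Q (h k)|

set_option linter.unusedSectionVars false

theorem aux_intg {Ω : Type*} [MeasurableSpace Ω] {μ : Measure Ω} [IsFiniteMeasure μ] {f : Ω → ℝ}
    (hf : Measurable f) {B : ℝ} (hB : ∀ x, |f x| ≤ B) : Integrable f μ :=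
  Integrable.of_bound hf.aestronglyMeasurable B (ae_of_all _ hB)

theorem aux_intg_exp {Ω : Type*} [MeasurableSpace Ω] {μ : Measure Ω} [IsFiniteMeasure μ] {f : Ω → ℝ}
    (hf : Measurable f) {B : ℝ} (hB : ∀ x, |f x| ≤ B) (t a : ℝ) :
    Integrable (fun x => Real.exp (t * (f x - a))) μ := by
  refine aux_intg (B := Real.exp (|t| * (B + |a|))) (by fun_prop) fun x => ?_
  rw [abs_of_pos (Real.exp_pos _)]
  apply Real.exp_le_exp.2
  calc t * (f x - a) ≤ |t * (f x - a)| := le_abs_self _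
    _ = |t| * |f x - a| := abs_mul _ _
    _ ≤ _ := by
      gcongr
      exact (abs_sub _ _).trans (by gcongr; exact hB x)

theorem aux_abs_int {Ω : Type*} [MeasurableSpace Ω] {μ : Measure Ω} [IsProbabilityMeasure μ]
    {f : Ω → ℝ} {B : ℝ} (hB : ∀ x, |f x| ≤ B) : |∫ x, f x ∂μ| ≤ B := by
  have := norm_integral_le_of_norm_le_const (μ := μ) (f := f) (C := B) (ae_of_all _ hB)
  simpa using this

theorem aux_hoeff {Ω : Type*} [MeasurableSpace Ω] {μ : Measure Ω} [IsProbabilityMeasure μ] {f : Ω → ℝ}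
    (hf : Measurable f) {B c : ℝ} (hB : ∀ x, |f x| ≤ B) (hd : ∀ x y, f x ≤ f y + c) (t : ℝ) :
    ∫ x, Real.exp (t * (f x - ∫ y, f y ∂μ)) ∂μ ≤ Real.exp (c ^ 2 / 4 * t ^ 2 / 2) := by
  have : Nonempty Ω := nonempty_of_isProbabilityMeasure μ
  have hbd : BddBelow (Set.range f) := ⟨-B, by rintro _ ⟨x, rfl⟩; exact (abs_le.1 (hB x)).1⟩
  have h := ProbabilityTheory.hasSubgaussianMGF_of_mem_Icc (μ := μ) (X := f) (a := ⨅ x, f x)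
    (b := (⨅ x, f x) + c) hf.aemeasurable (ae_of_all _ fun x => ⟨ciInf_le hbd x, by
      rw [← sub_le_iff_le_add]
      exact le_ciInf fun y => by linarith [hd x y]⟩)
  have := h.mgf_le t
  rw [ProbabilityTheory.mgf] at this
  refine this.trans (le_of_eq ?_)
  congr 3
  simp [div_pow]
  norm_num

theorem mcd_fin {Z : Type*} [MeasurableSpace Z] : ∀ (n : ℕ) (ν : Fin n → Measure Z)
    [∀ i, IsProbabilityMeasure (ν i)] (c : Fin n → ℝ) (f : (Fin n → Z) → ℝ) (_ : Measurable f)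
    (B : ℝ) (_ : ∀ x, |f x| ≤ B) (_ : ∀ x i z, f x ≤ f (Function.update x i z) + c i) (t : ℝ),
    ∫ x, Real.exp (t * (f x - ∫ y, f y ∂(Measure.pi ν))) ∂(Measure.pi ν) ≤
      Real.exp ((∑ i, c i ^ 2) / 4 * t ^ 2 / 2) := by
  intro n
  induction n with
  | zero =>
    intro ν _ c f hf B hB hd t
    have : ∀ x, f x = f default := fun x => by rw [Subsingleton.elim x default]
    simp [this]
  | succ n ih =>
    intro ν _ c f hf B hB hd t
    set ν' : Fin n → Measure Z := fun j => ν ((0 : Fin (n+1)).succAbove j) with hν'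
    have mp := (measurePreserving_piFinSuccAbove ν 0).symm
    set e := (MeasurableEquiv.piFinSuccAbove (fun _ : Fin (n+1) => Z) 0).symm with he
    have hev : ∀ z x, e (z, x) = Fin.cons z x := by
      intro z x; simp [he, MeasurableEquiv.piFinSuccAbove, Fin.insertNthEquiv]
    have hfe : Measurable fun p => f (e p) := hf.comp e.measurable
    have hfe1 : ∀ x, Measurable fun z => f (e (z, x)) := fun x => hfe.comp (by fun_prop)
    set F : (Fin n → Z) → ℝ := fun x => ∫ z, f (e (z, x)) ∂(ν 0) with hF
    have hFm : Measurable F :=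
      (hfe.stronglyMeasurable.integral_prod_left' (μ := ν 0)).measurable
    have hFB : ∀ x, |F x| ≤ B := fun x => aux_abs_int fun z => hB _
    have hFd : ∀ x i z, F x ≤ F (Function.update x i z) + c i.succ := by
      intro x i z
      rw [← sub_le_iff_le_add', hF]
      dsimp only
      rw [← integral_sub (aux_intg (hfe1 _) fun z => hB _) (aux_intg (hfe1 _) fun z => hB _)]
      have : ∫ a, (f (e (a, x)) - f (e (a, Function.update x i z))) ∂(ν 0) ≤ ∫ a, c i.succ ∂(ν 0) := by
        refine integral_mono (aux_intg (B := B + B) ((hfe1 _).sub (hfe1 _)) fun z => ?_) (integrable_const _) ?_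
        · exact (abs_sub _ _).trans (add_le_add (hB _) (hB _))
        · intro a
          have := hd (Fin.cons a x) i.succ z
          rw [← Fin.cons_update] at this
          simp only [hev]; linarith
      simpa using this
    have hEf : ∫ y, f y ∂(Measure.pi ν) = ∫ x, F x ∂(Measure.pi ν') := by
      rw [← mp.integral_comp' (g := f), integral_prod_symm _ (aux_intg hfe fun _ => hB _)]
    have hhead : ∀ x, ∫ z, Real.exp (t * (f (e (z, x)) - F x)) ∂(ν 0) ≤ Real.exp (c 0 ^ 2 / 4 * t ^ 2 / 2) := by
      intro x
      refine aux_hoeff (hfe1 x) (fun _ => hB _) (fun z w => ?_) t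
      have := hd (Fin.cons z x) 0 w
      rw [Fin.update_cons_zero] at this
      simpa only [hev] using this
    have htail := ih ν' (fun i => c i.succ) F hFm B hFB hFd t
    rw [hEf]
    set E := ∫ x, F x ∂(Measure.pi ν')
    rw [← mp.integral_comp' (g := fun x => Real.exp (t * (f x - E))),
      integral_prod_symm _ (aux_intg_exp hfe (fun _ => hB _) t E)]
    calc ∫ x, ∫ z, Real.exp (t * (f (e (z, x)) - E)) ∂(ν 0) ∂(Measure.pi ν')
        ≤ ∫ x, Real.exp (t * (F x - E)) * Real.exp (c 0 ^ 2 / 4 * t ^ 2 / 2) ∂(Measure.pi ν') := by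
          refine integral_mono (aux_intg_exp hfe (fun _ => hB _) t E).integral_prod_right
            ((aux_intg_exp hFm hFB t E).mul_const _) fun x => ?_
          dsimp only
          have : ∀ z, Real.exp (t * (f (e (z, x)) - E)) =
              Real.exp (t * (F x - E)) * Real.exp (t * (f (e (z, x)) - F x)) := by
            intro z; rw [← Real.exp_add]; congr 1; ring
          simp_rw [this]
          rw [integral_const_mul]
          gcongr
          exact hhead x
      _ ≤ Real.exp ((∑ i : Fin n, c i.succ ^ 2) / 4 * t ^ 2 / 2) * Real.exp (c 0 ^ 2 / 4 * t ^ 2 / 2) := by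
          rw [integral_mul_const]
          gcongr
      _ = _ := by
          rw [← Real.exp_add, Fin.sum_univ_succ]; congr 1; ring

theorem mcd {J Z : Type*} [Fintype J] [DecidableEq J] [MeasurableSpace Z] (ν : J → Measure Z)
    [∀ i, IsProbabilityMeasure (ν i)] (c : J → ℝ) (f : (J → Z) → ℝ) (hf : Measurable f)
    (B : ℝ) (hB : ∀ x, |f x| ≤ B) (hd : ∀ x i z, f x ≤ f (Function.update x i z) + c i) (s : ℝ)
    (hs : 0 ≤ s) :
    (Measure.pi ν) {x | (∫ y, f y ∂(Measure.pi ν)) + s ≤ f x} ≤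
      ENNReal.ofReal (Real.exp (- (2 * s ^ 2) / (∑ i, c i ^ 2))) := by
  have hmgf : ∀ t, ∫ x, Real.exp (t * (f x - ∫ y, f y ∂(Measure.pi ν))) ∂(Measure.pi ν) ≤
      Real.exp ((∑ i, c i ^ 2) / 4 * t ^ 2 / 2) := by
    intro t
    set e := (Fintype.equivFin J).symm
    have mp := measurePreserving_piCongrLeft (α := fun _ : J => Z) ν e
    set g := MeasurableEquiv.piCongrLeft (fun _ : J => Z) e
    have hg : ∀ x j, g x j = x (e.symm j) := by
      intro x j
      obtain ⟨i, rfl⟩ := e.surjective j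
      simp [g, MeasurableEquiv.piCongrLeft, Equiv.piCongrLeft_apply_apply]
    have := mcd_fin _ (fun i => ν (e i)) (fun i => c (e i)) (fun x => f (g x)) (hf.comp g.measurable) B
      (fun _ => hB _) (fun x i z => by
        have := hd (g x) (e i) z
        convert this using 3
        ext j
        rw [hg]
        by_cases h : j = e i
        · subst h; simp
        · rw [Function.update_of_ne h, Function.update_of_ne, hg]
          rintro rfl; simp at h) t
    rw [mp.integral_comp' (g := f)] at this
    rw [← mp.integral_comp' (g := fun x => Real.exp (t * (f x - ∫ y, f y ∂(Measure.pi ν))))]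
    rw [e.sum_comp (fun i => c i ^ 2)] at this
    exact this
  have hsg : ProbabilityTheory.HasSubgaussianMGF (fun x => f x - ∫ y, f y ∂(Measure.pi ν))
      (Real.toNNReal ((∑ i, c i ^ 2) / 4)) (Measure.pi ν) := by
    refine ⟨fun t => aux_intg_exp hf hB t _, fun t => ?_⟩
    rw [Real.coe_toNNReal _ (by positivity)]
    exact hmgf t
  have := hsg.measure_ge_le hs
  rw [Real.coe_toNNReal _ (by positivity)] at this
  rw [← ENNReal.ofReal_toReal (measure_ne_top _ _)]
  apply ENNReal.ofReal_le_ofReal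
  convert this using 1
  · rw [Measure.real]; congr 3; ext x; simp [le_sub_iff_add_le']
  · congr 1
    by_cases h : ∑ i, c i ^ 2 = 0
    · simp [h]
    · field_simp; ring


theorem aux_radSign_abs (b : Bool) : |radSign b| = 1 := by cases b <;> simp [radSign]

theorem aux_radSign_not (b : Bool) : radSign (!b) = - radSign b := by cases b <;> simp [radSign]

theorem aux_radSign_meas : Measurable radSign := Measurable.of_discrete

theorem aux_bdd {ι : Type*} {a : ι → ℝ} {B : ℝ} (hB : ∀ k, |a k| ≤ B) : BddAbove (Set.range a) :=
  ⟨B, by rintro _ ⟨k, rfl⟩; exact (abs_le.1 (hB k)).2⟩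

theorem aux_abs_sup {ι : Type*} [Nonempty ι] {a : ι → ℝ} {B : ℝ} (hB : ∀ k, |a k| ≤ B) :
    |⨆ k, a k| ≤ B := by
  obtain ⟨k⟩ := ‹Nonempty ι›
  have : Nonempty ι := ⟨k⟩
  rw [abs_le]
  exact ⟨(abs_le.1 (hB k)).1.trans (le_ciSup (aux_bdd hB) k), ciSup_le fun k => (abs_le.1 (hB k)).2⟩

theorem aux_mp {Ω Ω' : Type*} [MeasurableSpace Ω] [MeasurableSpace Ω'] {μ : Measure Ω}
    {μ' : Measure Ω'} {T : Ω → Ω'} (hT : MeasurePreserving T μ μ') {g : Ω' → ℝ} (hg : Measurable g) :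
    ∫ x, g (T x) ∂μ = ∫ y, g y ∂μ' := by
  rw [← hT.map_eq, integral_map hT.measurable.aemeasurable hg.aestronglyMeasurable]

theorem aux_sum_abs {J : Type*} [Fintype J] {a c : J → ℝ} (h : ∀ j, |a j| ≤ c j) :
    |∑ j, a j| ≤ ∑ j, c j :=
  (Finset.abs_sum_le_sum_abs _ _).trans (Finset.sum_le_sum fun j _ => h j)

def radU (J : Type*) [Fintype J] : Measure (J → Bool) :=
  Measure.pi fun _ => (PMF.uniformOfFintype Bool).toMeasure

instance {J : Type*} [Fintype J] : IsProbabilityMeasure (radU J) := by unfold radU; infer_instance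

theorem radU_not {J : Type*} [Fintype J] :
    MeasurePreserving (fun (σ : J → Bool) j => !(σ j)) (radU J) (radU J) := by
  unfold radU
  refine measurePreserving_pi _ _ (f := fun _ b => !b) fun j => ?_
  refine ⟨Measurable.of_discrete, ?_⟩
  refine Measure.ext_of_singleton fun b => ?_
  rw [Measure.map_apply Measurable.of_discrete (measurableSet_singleton _)]
  have : (fun b => !b) ⁻¹' {b} = {!b} := by ext x; cases x <;> cases b <;> simp
  rw [this]
  simp

section sym
variable {ι J Z : Type*} [Countable ι] [Nonempty ι] [Fintype J] [MeasurableSpace Z]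

def SR (F : ι → J → Z → ℝ) (σ : J → Bool) (S : J → Z) : ℝ :=
  ⨆ k, ∑ j, radSign (σ j) * F k j (S j)

theorem SR_abs {F : ι → J → Z → ℝ} {c : J → ℝ} (hc : ∀ k j z, |F k j z| ≤ c j) (σ : J → Bool)
    (S : J → Z) : |SR F σ S| ≤ ∑ j, c j :=
  aux_abs_sup fun k => aux_sum_abs fun j => by
    rw [abs_mul, aux_radSign_abs, one_mul]; exact hc _ _ _

theorem SR_le {F : ι → J → Z → ℝ} {c : J → ℝ} (hc : ∀ k j z, |F k j z| ≤ c j) (σ : J → Bool)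
    (S : J → Z) (k : ι) : ∑ j, radSign (σ j) * F k j (S j) ≤ SR F σ S :=
  le_ciSup (f := fun k => ∑ j, radSign (σ j) * F k j (S j)) (aux_bdd (B := ∑ j, c j)
   fun k => aux_sum_abs fun j => by
    rw [abs_mul, aux_radSign_abs, one_mul]; exact hc _ _ _) k

theorem SR_meas {F : ι → J → Z → ℝ} (hF : ∀ k j, Measurable (F k j)) :
    Measurable fun p : (J → Bool) × (J → Z) => SR F p.1 p.2 := by
  have := aux_radSign_meas
  unfold SR
  refine Measurable.iSup fun k => Finset.measurable_sum _ fun j _ => ?_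
  have h1 : Measurable fun p : (J → Bool) × (J → Z) => radSign (p.1 j) := this.comp (by fun_prop)
  have h2 : Measurable fun p : (J → Bool) × (J → Z) => F k j (p.2 j) := (hF k j).comp (by fun_prop)
  exact h1.mul h2

set_option maxHeartbeats 1000000 in
theorem symm_bound (ν : J → Measure Z) [∀ j, IsProbabilityMeasure (ν j)]
    {F : ι → J → Z → ℝ} (hF : ∀ k j, Measurable (F k j)) {c : J → ℝ}
    (hc : ∀ k j z, |F k j z| ≤ c j) :
    ∫ S, (⨆ k, ∑ j, ((∫ z, F k j z ∂(ν j)) - F k j (S j))) ∂(Measure.pi ν) ≤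
      2 * ∫ S, ∫ σ, SR F σ S ∂(radU J) ∂(Measure.pi ν) := by
  classical
  set μ := Measure.pi ν with hμ
  have hFe : ∀ k j, Measurable fun S : J → Z => F k j (S j) := fun k j =>
    (hF k j).comp (measurable_pi_apply j)
  set G : (J → Z) × (J → Z) → ℝ := fun p => ⨆ k, ∑ j, (F k j (p.2 j) - F k j (p.1 j)) with hG
  have hGb' : ∀ (p : (J → Z) × (J → Z)) k, |∑ j, (F k j (p.2 j) - F k j (p.1 j))| ≤ ∑ j, (c j + c j) :=
    fun p k => aux_sum_abs fun j => (abs_sub _ _).trans (add_le_add (hc _ _ _) (hc _ _ _))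
  have hGb : ∀ p, |G p| ≤ ∑ j, (c j + c j) := fun p => aux_abs_sup (hGb' p)
  have hGm : Measurable G := by
    refine Measurable.iSup fun k => Finset.measurable_sum _ fun j _ => ?_
    exact ((hFe k j).comp measurable_snd).sub ((hFe k j).comp measurable_fst)
  have hsr1 : ∀ σ, Measurable (SR F σ) := fun σ => (SR_meas hF).comp (by fun_prop : Measurable fun S => (σ, S))
  set A : (J → Bool) → ℝ := fun σ => ∫ S, SR F σ S ∂μ with hA
  -- step 1
  have step1 : ∫ S, (⨆ k, ∑ j, ((∫ z, F k j z ∂(ν j)) - F k j (S j))) ∂μ ≤ ∫ p, G p ∂(μ.prod μ) := by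
    rw [integral_prod _ (aux_intg hGm hGb)]
    refine integral_mono (aux_intg (B := ∑ j, (c j + c j)) ?_ ?_)
      (aux_intg hGm hGb).integral_prod_left ?_
    · exact Measurable.iSup fun k => Finset.measurable_sum _ fun j _ => (hFe k j).const_sub _
    · exact fun S => aux_abs_sup fun k => aux_sum_abs fun j =>
        (abs_sub _ _).trans (add_le_add (aux_abs_int (hc k j)) (hc _ _ _))
    · intro S
      refine ciSup_le fun k => ?_
      have h1 : ∑ j, ((∫ z, F k j z ∂(ν j)) - F k j (S j)) =
          ∫ S', ∑ j, (F k j (S' j) - F k j (S j)) ∂μ := by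
        have hi : ∀ j, Integrable (fun S' : J → Z => F k j (S' j) - F k j (S j)) μ := fun j =>
          (aux_intg (hFe k j) fun _ => hc _ _ _).sub (integrable_const _)
        rw [integral_finsetSum _ fun j _ => hi j]
        refine Finset.sum_congr rfl fun j _ => ?_
        rw [integral_sub (aux_intg (hFe k j) fun _ => hc _ _ _) (integrable_const _)]
        rw [aux_mp (measurePreserving_eval ν j) (hF k j)]
        simp
      rw [h1]
      refine integral_mono (aux_intg ?_ fun S' => hGb' (S, S') k)
        (aux_intg (hGm.comp (by fun_prop : Measurable fun S' => (S, S'))) fun _ => hGb _) fun S' => ?_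
      · exact Finset.measurable_sum _ fun j _ => (hFe k j).sub_const _
      · exact le_ciSup (aux_bdd (hGb' (S, S'))) k
  -- step 2
  have step2 : ∀ σ : J → Bool, ∫ p, G p ∂(μ.prod μ) ≤ A σ + A (fun j => !(σ j)) := by
    intro σ
    have mpe := measurePreserving_arrowProdEquivProdArrow Z Z J ν ν
    set e := MeasurableEquiv.arrowProdEquivProdArrow Z Z J
    have mpT : MeasurePreserving (fun (a : J → Z × Z) j => if σ j then a j else (a j).swap)
        (Measure.pi fun j => (ν j).prod (ν j)) (Measure.pi fun j => (ν j).prod (ν j)) := by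
      refine measurePreserving_pi _ _ (f := fun j (a : Z × Z) => if σ j then a else a.swap) fun j => ?_
      cases σ j
      · simpa using Measure.measurePreserving_swap
      · simp only [if_true]; exact MeasurePreserving.id _
    set G2 : (J → Z) × (J → Z) → ℝ := fun p => SR F σ p.2 + SR F (fun j => !(σ j)) p.1 with hG2
    have hG2i1 : Integrable (fun p : (J → Z) × (J → Z) => SR F σ p.2) (μ.prod μ) :=
      aux_intg ((hsr1 σ).comp measurable_snd) fun _ => SR_abs hc _ _
    have hG2i2 : Integrable (fun p : (J → Z) × (J → Z) => SR F (fun j => !(σ j)) p.1) (μ.prod μ) :=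
      aux_intg ((hsr1 _).comp measurable_fst) fun _ => SR_abs hc _ _
    have hG2m : Measurable G2 := ((hsr1 σ).comp measurable_snd).add ((hsr1 _).comp measurable_fst)
    have hG2b : ∀ p, |G2 p| ≤ ∑ j, c j + ∑ j, c j := fun p =>
      (abs_add_le _ _).trans (add_le_add (SR_abs hc _ _) (SR_abs hc _ _))
    calc ∫ p, G p ∂(μ.prod μ) = ∫ a, G (e a) ∂(Measure.pi fun j => (ν j).prod (ν j)) :=
          (aux_mp mpe hGm).symm
      _ = ∫ a, G (e (fun j => if σ j then a j else (a j).swap))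
            ∂(Measure.pi fun j => (ν j).prod (ν j)) :=
          (aux_mp mpT (hGm.comp e.measurable)).symm
      _ ≤ ∫ a, G2 (e a) ∂(Measure.pi fun j => (ν j).prod (ν j)) := by
          refine integral_mono (aux_intg ((hGm.comp e.measurable).comp mpT.measurable) fun _ => hGb _)
            (aux_intg (hG2m.comp e.measurable) fun _ => hG2b _) fun a => ?_
          refine ciSup_le fun k => ?_
          have h1 := SR_le hc σ (fun j => (a j).2) k
          have h2 := SR_le hc (fun j => !(σ j)) (fun j => (a j).1) k
          refine le_trans (le_of_eq ?_) (add_le_add h1 h2)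
          rw [← Finset.sum_add_distrib]
          refine Finset.sum_congr rfl fun j _ => ?_
          rw [aux_radSign_not]
          simp only [e, MeasurableEquiv.arrowProdEquivProdArrow, Equiv.arrowProdEquivProdArrow]
          cases hσ : σ j <;> simp [radSign, hσ] <;> ring
      _ = ∫ p, G2 p ∂(μ.prod μ) := aux_mp mpe hG2m
      _ = _ := by
          rw [hG2, integral_add hG2i1 hG2i2]
          rw [aux_mp (measurePreserving_snd (μ := μ) (ν := μ)) (hsr1 σ),
            aux_mp (measurePreserving_fst (μ := μ) (ν := μ)) (hsr1 _)]
  have hAi : ∀ f : (J → Bool) → ℝ, Integrable f (radU J) := fun f => Integrable.of_finite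
  have step3 : ∫ p, G p ∂(μ.prod μ) ≤ 2 * ∫ σ, A σ ∂(radU J) := by
    have h1 : ∫ _σ, (∫ p, G p ∂(μ.prod μ)) ∂(radU J) ≤ ∫ σ, (A σ + A (fun j => !(σ j))) ∂(radU J) :=
      integral_mono (hAi _) (hAi _) step2
    rw [integral_add (hAi _) (hAi _), aux_mp radU_not (g := A) Measurable.of_discrete] at h1
    simp at h1
    linarith
  refine (step1.trans step3).trans (le_of_eq ?_)
  congr 1
  rw [hA, integral_integral_swap]
  exact aux_intg (SR_meas hF) fun _ => SR_abs hc _ _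

theorem SR_neg_int (F : ι → J → Z → ℝ) (S : J → Z) :
    ∫ σ, SR (fun k j z => - F k j z) σ S ∂(radU J) = ∫ σ, SR F σ S ∂(radU J) := by
  rw [← aux_mp radU_not (g := fun σ => SR F σ S) Measurable.of_discrete]
  congr 1; ext σ
  unfold SR
  simp [aux_radSign_not]

theorem aux_sum_update [DecidableEq J] (g : J → Z → ℝ) (x : J → Z) (i : J) (z : Z) :
    ∑ j, g j (Function.update x i z j) = ∑ j, g j (x j) + (g i z - g i (x i)) := by
  rw [← sub_eq_iff_eq_add', ← Finset.sum_sub_distrib, Finset.sum_eq_single i]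
  · simp
  · intro j _ hj; simp [Function.update_of_ne hj]
  · simp

theorem one_side [DecidableEq J] (ν : J → Measure Z) [∀ j, IsProbabilityMeasure (ν j)]
    {F : ι → J → Z → ℝ} (hF : ∀ k j, Measurable (F k j)) {c : J → ℝ}
    (hc : ∀ k j z, |F k j z| ≤ c j) (hd : ∀ k j z z', F k j z - F k j z' ≤ c j)
    (s : ℝ) (hs : 0 ≤ s) :
    (Measure.pi ν) {S | ∃ k, 2 * (∫ S, ∫ σ, SR F σ S ∂(radU J) ∂(Measure.pi ν)) + s ≤
      ∑ j, ((∫ z, F k j z ∂(ν j)) - F k j (S j))} ≤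
      ENNReal.ofReal (Real.exp (- (2 * s ^ 2) / (∑ i, c i ^ 2))) := by
  have hb : ∀ (S : J → Z) k, |∑ j, ((∫ z, F k j z ∂(ν j)) - F k j (S j))| ≤ ∑ j, (c j + c j) :=
    fun S k => aux_sum_abs fun j => (abs_sub _ _).trans (add_le_add (aux_abs_int (hc k j)) (hc _ _ _))
  have := mcd ν c (fun S => ⨆ k, ∑ j, ((∫ z, F k j z ∂(ν j)) - F k j (S j)))
    (Measurable.iSup fun k => Finset.measurable_sum _ fun j _ =>
      ((hF k j).comp (measurable_pi_apply j)).const_sub _)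
    (∑ j, (c j + c j)) (fun S => aux_abs_sup (hb S))
    (fun x i z => ciSup_le fun k => by
      have h1 := le_ciSup (aux_bdd (hb (Function.update x i z))) k
      refine le_trans ?_ (add_le_add_left h1 _)
      rw [aux_sum_update (fun j z => (∫ z, F k j z ∂(ν j)) - F k j z)]
      linarith [hd k i z (x i)]) s hs
  refine le_trans (measure_mono ?_) this
  rintro S ⟨k, hk⟩
  have h1 := le_ciSup (aux_bdd (hb S)) k
  have h2 := symm_bound ν hF hc
  simp only [Set.mem_ofPred_eq]
  linarith

theorem flat_bound [DecidableEq J] (ν : J → Measure Z) [∀ j, IsProbabilityMeasure (ν j)]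
    {F : ι → J → Z → ℝ} (hF : ∀ k j, Measurable (F k j)) {c : J → ℝ}
    (hc0 : ∀ k j z, 0 ≤ F k j z) (hc : ∀ k j z, F k j z ≤ c j)
    (R : (J → Z) → ℝ) (hRm : Measurable R) (B : ℝ) (hRB : ∀ S, |R S| ≤ B)
    (hRd : ∀ x i z, R x ≤ R (Function.update x i z) + c i)
    (hR : ∀ S, ∫ σ, SR F σ S ∂(radU J) ≤ R S)
    (s : ℝ) (hs : 0 ≤ s) :
    (Measure.pi ν) {S | ∀ k, |∑ j, ((∫ z, F k j z ∂(ν j)) - F k j (S j))| ≤ 2 * R S + 3 * s}ᶜ ≤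
      3 * ENNReal.ofReal (Real.exp (- (2 * s ^ 2) / (∑ i, c i ^ 2))) := by
  have hca : ∀ k j z, |F k j z| ≤ c j := fun k j z => by
    rw [abs_of_nonneg (hc0 _ _ _)]; exact hc _ _ _
  have h1 := one_side ν hF hca (fun k j z z' => by linarith [hc k j z, hc0 k j z']) s hs
  have h2 := one_side ν (F := fun k j z => - F k j z) (fun k j => (hF k j).neg) (c := c)
    (fun k j z => by rw [abs_neg]; exact hca _ _ _)
    (fun k j z z' => by linarith [hc k j z', hc0 k j z]) s hs
  have h3 := mcd ν c (fun S => - R S) hRm.neg B (fun S => by rw [abs_neg]; exact hRB S)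
    (fun x i z => by
      have := hRd (Function.update x i z) i (x i)
      simp at this
      linarith) s hs
  simp_rw [SR_neg_int] at h2
  set E := ∫ S, ∫ σ, SR F σ S ∂(radU J) ∂(Measure.pi ν) with hE
  have hER : E ≤ ∫ S, R S ∂(Measure.pi ν) := by
    refine integral_mono ?_ (aux_intg hRm hRB) hR
    have := SR_meas hF
    exact (aux_intg (μ := (radU J).prod (Measure.pi ν)) this
      (fun _ => SR_abs hca _ _)).integral_prod_right
  refine le_trans (measure_mono ?_) ((measure_union_le _ _).trans (add_le_add
    ((measure_union_le _ _).trans (add_le_add h1 h2)) h3)) |>.trans (le_of_eq (by ring))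
  intro S hS
  by_contra hn
  simp only [Set.mem_union, Set.mem_ofPred_eq, not_or, not_exists, not_le] at hn
  obtain ⟨⟨n1, n2⟩, n3⟩ := hn
  apply hS
  intro k
  rw [integral_neg] at n3
  have n1 := n1 k
  have n2 := n2 k
  have : ∑ j, ((∫ z, - F k j z ∂(ν j)) - - F k j (S j)) =
      - ∑ j, ((∫ z, F k j z ∂(ν j)) - F k j (S j)) := by
    rw [← Finset.sum_neg_distrib]
    refine Finset.sum_congr rfl fun j _ => ?_
    rw [integral_neg]; ring
  rw [this] at n2
  rw [abs_le]
  constructor <;> linarith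
end sym

theorem aux_curry {Z : Type*} [MeasurableSpace Z] {N : ℕ} (m : Fin N → ℕ)
    (D : (i : Fin N) → Fin (m i) → Measure Z) [∀ i j, IsProbabilityMeasure (D i j)] :
    MeasurePreserving (MeasurableEquiv.piCurry (fun (i : Fin N) (_ : Fin (m i)) => Z))
      (Measure.pi fun p : (i : Fin N) × Fin (m i) => D p.1 p.2)
      (Measure.pi fun i => Measure.pi fun j => D i j) := by
  refine ⟨MeasurableEquiv.measurable _, ?_⟩
  have := Measure.infinitePi_map_piCurry (X := fun (i : Fin N) (_ : Fin (m i)) => Z) D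
  simp_rw [Measure.infinitePi_eq_pi] at this
  exact this

instance {N : ℕ} (m : Fin N → ℕ) : IsProbabilityMeasure (radMeasure N m) := by
  unfold radMeasure; infer_instance

section radc
variable {ι : Type*} [Nonempty ι]
  {L : Y → Y → ℝ} {M : ℝ} (hL0 : ∀ y y', 0 ≤ L y y') (hLM : ∀ y y', L y y' ≤ M)
  (h : ι → X → Y) {N : ℕ} (m : Fin N → ℕ)

theorem aux_term_abs {n : ℕ} (hn : 1 ≤ n) (hL0 : ∀ y y', 0 ≤ L y y') (hLM : ∀ y y', L y y' ≤ M)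
    (h : ι → X → Y) (s : Fin n → X × Y) (σ : Fin n → Bool) (k : ι) :
    |(1 / (n : ℝ)) * ∑ j, radSign (σ j) * L (h k (s j).1) (s j).2| ≤ M := by
  have hn' : (0 : ℝ) < n := by exact_mod_cast hn
  rw [abs_mul, abs_of_pos (by positivity)]
  have : |∑ j, radSign (σ j) * L (h k (s j).1) (s j).2| ≤ ∑ _j : Fin n, M :=
    aux_sum_abs fun j => by
      rw [abs_mul, aux_radSign_abs, one_mul, abs_of_nonneg (hL0 _ _)]; exact hLM _ _
  simp at this
  rw [one_div, inv_mul_le_iff₀ hn']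
  exact this

end radc

/-- Proposition 1: uniform two-sided deviation bound between the α-weighted expected
and empirical risks. -/
theorem uniform_deviation_bound {ι : Type*} [Countable ι] [Nonempty ι]
    (L : Y → Y → ℝ) (hLmeas : Measurable (Function.uncurry L))
    (M : ℝ) (hM : 0 < M) (hL0 : ∀ y y', 0 ≤ L y y') (hLM : ∀ y y', L y y' ≤ M)
    (h : ι → X → Y) (hmeas : ∀ k, Measurable (h k))
    {N : ℕ} (D : Fin N → Measure (X × Y)) [∀ i, IsProbabilityMeasure (D i)]
    (m : Fin N → ℕ) (hm : ∀ i, 1 ≤ m i)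
    (α : Fin N → ℝ) (hα : ∀ i, 0 ≤ α i) (hαs : ∑ i, α i = 1)
    (δ : ℝ) (hδ : 0 < δ) :
    ENNReal.ofReal (1 - δ) ≤
      sampleMeasure m D
        {S | ∀ k : ι,
          |(∑ i, α i * expRisk L (D i) (h k)) - empRisk L m α S (h k)| ≤
            2 * ∑ i, α i * radComplexity L h m S i
            + 3 * Real.sqrt (Real.log (4 / δ) * M ^ 2 / 2)
                * Real.sqrt (∑ i, α i ^ 2 / (m i : ℝ))} := by
  rcases le_or_gt 1 δ with h1 | h1
  · rw [ENNReal.ofReal_of_nonpos (by linarith)]; exact zero_le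
  have hm' : ∀ i, (0 : ℝ) < m i := fun i => by exact_mod_cast hm i
  have hLk : ∀ k, Measurable fun z : X × Y => L (h k z.1) z.2 := fun k =>
    hLmeas.comp (((hmeas k).comp measurable_fst).prodMk measurable_snd)
  set V := ∑ i, α i ^ 2 / (m i : ℝ) with hV
  have hVpos : 0 < V := by
    have hex : ∃ i, α i ≠ 0 := by
      by_contra hne
      push Not at hne
      simp [hne] at hαs
    obtain ⟨i, hi⟩ := hex
    refine Finset.sum_pos' (fun i _ => by have := hm' i; positivity) ⟨i, Finset.mem_univ _, ?_⟩
    have := hm' i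
    positivity
  have hlog : 0 < Real.log (4 / δ) := Real.log_pos (by rw [lt_div_iff₀ hδ]; linarith)
  set s := Real.sqrt (Real.log (4 / δ) * M ^ 2 / 2) * Real.sqrt V with hs
  have hs0 : 0 ≤ s := by positivity
  have hs2 : s ^ 2 = Real.log (4 / δ) * M ^ 2 / 2 * V := by
    rw [hs, mul_pow, Real.sq_sqrt (by positivity), Real.sq_sqrt hVpos.le]
  -- flat objects
  set F : ι → ((i : Fin N) × Fin (m i)) → X × Y → ℝ :=
    fun k p z => α p.1 / m p.1 * L (h k z.1) z.2 with hF
  set c : ((i : Fin N) × Fin (m i)) → ℝ := fun p => α p.1 / m p.1 * M with hc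
  set e := MeasurableEquiv.piCurry (fun (i : Fin N) (_ : Fin (m i)) => X × Y) with he
  have hev : ∀ S i j, e S i j = S ⟨i, j⟩ := fun S i j => rfl
  set R : (((i : Fin N) × Fin (m i)) → X × Y) → ℝ :=
    fun S => ∑ i, α i * radComplexity L h m (e S) i with hR
  have hαm : ∀ i, 0 ≤ α i / m i := fun i => div_nonneg (hα i) (hm' i).le
  have hc2 : ∑ p, c p ^ 2 = M ^ 2 * V := by
    rw [Fintype.sum_sigma, hV, Finset.mul_sum]
    refine Finset.sum_congr rfl fun i _ => ?_
    have := hm' i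
    simp [hc]
    field_simp
  have hradb : ∀ S i, |radComplexity L h m S i| ≤ M := fun S i =>
    aux_abs_int fun σ => aux_abs_sup fun k => aux_term_abs (hm i) hL0 hLM h (S i) (σ i) k
  have hint : ∀ f : ((i : Fin N) → Fin (m i) → Bool) → ℝ, Integrable f (radMeasure N m) :=
    fun f => Integrable.of_finite
  have key := flat_bound (fun p : (i : Fin N) × Fin (m i) => D p.1) (F := F) (c := c)
    (fun k p => (hLk k).const_mul _)
    (fun k p z => mul_nonneg (hαm _) (hL0 _ _))
    (fun k p z => mul_le_mul_of_nonneg_left (hLM _ _) (hαm _)) R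
    (by
      refine Finset.measurable_sum _ fun i _ => Measurable.const_mul ?_ _
      unfold radComplexity
      have : Measurable (Function.uncurry fun (S : ((i : Fin N) × Fin (m i)) → X × Y)
          (σ : (i : Fin N) → Fin (m i) → Bool) =>
          (⨆ k, (1 / (m i : ℝ)) * ∑ j, radSign (σ i j) * L (h k (e S i j).1) (e S i j).2)) := by
        refine Measurable.iSup fun k => Measurable.const_mul
          (Finset.measurable_sum _ fun j _ => ?_) _
        refine Measurable.mul (aux_radSign_meas.comp (by fun_prop)) ?_
        simp only [hev]
        exact (hLk k).comp ((measurable_pi_apply (⟨i, j⟩ : (i : Fin N) × Fin (m i))).comp measurable_fst)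
      exact (this.stronglyMeasurable.integral_prod_right).measurable)
    (∑ i, α i * M)
    (fun S => aux_sum_abs fun i => by
      rw [abs_mul, abs_of_nonneg (hα i)]
      exact mul_le_mul_of_nonneg_left (hradb _ _) (hα i))
    (by
      intro x p z
      have hstep : ∀ i, radComplexity L h m (e x) i ≤ radComplexity L h m (e (Function.update x p z)) i
          + (1 / (m i : ℝ)) * ∑ j : Fin (m i), (if (⟨i, j⟩ : (i : Fin N) × Fin (m i)) = p then M else 0) := by
        intro i
        rw [← sub_le_iff_le_add']
        unfold radComplexity
        rw [← integral_sub (hint _) (hint _)]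
        refine (integral_mono (hint _) (hint (fun _ => (1 / (m i : ℝ)) * ∑ j : Fin (m i),
          (if (⟨i, j⟩ : (i : Fin N) × Fin (m i)) = p then M else 0))) fun σ => ?_).trans
          (le_of_eq (by simp))
        dsimp only
        rw [sub_le_iff_le_add']
        refine ciSup_le fun k => ?_
        have hle := le_ciSup (aux_bdd fun k =>
          aux_term_abs (hm i) hL0 hLM h (e (Function.update x p z) i) (σ i) k) k
        refine le_trans ?_ (add_le_add_left hle _)
        rw [← mul_add, ← Finset.sum_add_distrib]
        have := hm' i
        gcongr with j _
        rw [hev, hev]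
        split_ifs with hp
        · have ha := hL0 (h k (x ⟨i, j⟩).1) (x ⟨i, j⟩).2
          have hb := hLM (h k (x ⟨i, j⟩).1) (x ⟨i, j⟩).2
          have hc := hL0 (h k (Function.update x p z ⟨i, j⟩).1) (Function.update x p z ⟨i, j⟩).2
          have hd := hLM (h k (Function.update x p z ⟨i, j⟩).1) (Function.update x p z ⟨i, j⟩).2
          cases σ i j <;> simp [radSign] <;> linarith
        · rw [Function.update_of_ne hp]; simp
      calc R x ≤ ∑ i, α i * (radComplexity L h m (e (Function.update x p z)) i
          + (1 / (m i : ℝ)) * ∑ j : Fin (m i),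
            (if (⟨i, j⟩ : (i : Fin N) × Fin (m i)) = p then M else 0)) :=
            Finset.sum_le_sum fun i _ => mul_le_mul_of_nonneg_left (hstep i) (hα i)
        _ = R (Function.update x p z) + ∑ q : (i : Fin N) × Fin (m i),
            (if q = p then α q.1 / m q.1 * M else 0) := by
            rw [Fintype.sum_sigma, hR, ← Finset.sum_add_distrib]
            refine Finset.sum_congr rfl fun i _ => ?_
            rw [mul_add, ← mul_assoc, Finset.mul_sum]
            congr 1
            refine Finset.sum_congr rfl fun j _ => ?_
            split_ifs
            · ring
            · simp
        _ = _ := by simp [hc])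
    (by
      intro S
      have mpr := aux_curry m (fun i _ => (PMF.uniformOfFintype Bool).toMeasure)
      have hRS : R S = ∫ σ, ∑ i, α i * (⨆ k, (1 / (m i : ℝ)) * ∑ j, radSign (σ i j) *
          L (h k (e S i j).1) (e S i j).2) ∂(radMeasure N m) := by
        rw [integral_finsetSum _ fun i _ => hint _]
        refine Finset.sum_congr rfl fun i _ => ?_
        rw [integral_const_mul]; rfl
      rw [hRS]
      unfold radMeasure
      rw [← mpr.integral_comp']
      refine integral_mono Integrable.of_finite Integrable.of_finite fun σ => ?_
      refine ciSup_le fun k => ?_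
      rw [Fintype.sum_sigma]
      refine Finset.sum_le_sum fun i _ => ?_
      have hle := le_ciSup (aux_bdd fun k =>
          aux_term_abs (hm i) hL0 hLM h (e S i) (fun j => σ ⟨i, j⟩) k) k
      refine le_trans (le_of_eq ?_) (mul_le_mul_of_nonneg_left hle (hα i))
      rw [← mul_assoc, Finset.mul_sum]
      refine Finset.sum_congr rfl fun j _ => ?_
      simp only [hF, hev]
      ring)
    s hs0
  -- transfer
  have mps := aux_curry m (fun i _ => D i)
  set A := {S : (i : Fin N) → Fin (m i) → X × Y | ∀ k : ι,
          |(∑ i, α i * expRisk L (D i) (h k)) - empRisk L m α S (h k)| ≤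
            2 * ∑ i, α i * radComplexity L h m S i
            + 3 * Real.sqrt (Real.log (4 / δ) * M ^ 2 / 2) * Real.sqrt V} with hA
  set A' := {S | ∀ k, |∑ p : (i : Fin N) × Fin (m i), ((∫ z, F k p z ∂(D p.1)) - F k p (S p))| ≤
    2 * R S + 3 * s} with hA'
  have hpre : e ⁻¹' A = A' := by
    ext S
    simp only [hA, hA', Set.mem_preimage, Set.mem_ofPred_eq]
    refine forall_congr' fun k => ?_
    have : (∑ i, α i * expRisk L (D i) (h k)) - empRisk L m α (e S) (h k) =
        ∑ p : (i : Fin N) × Fin (m i), ((∫ z, F k p z ∂(D p.1)) - F k p (S p)) := by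
      rw [Fintype.sum_sigma, empRisk, ← Finset.sum_sub_distrib]
      refine Finset.sum_congr rfl fun i _ => ?_
      have := hm' i
      rw [Finset.sum_sub_distrib]
      simp only [hF, integral_const_mul, hev, ← Finset.mul_sum]
      simp only [Finset.sum_const, Finset.card_univ, Fintype.card_fin, nsmul_eq_mul, expRisk]
      congr 1
      field_simp
    rw [this, hs, ← mul_assoc]
  have hmeasA : sampleMeasure m D A = (Measure.pi fun p : (i : Fin N) × Fin (m i) => D p.1) A' := by
    rw [← hpre]; exact (mps.measure_preimage_equiv A).symm
  rw [hmeasA]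
  have hexp : Real.exp (- (2 * s ^ 2) / (∑ p, c p ^ 2)) = δ / 4 := by
    rw [hc2, hs2]
    have : - (2 * (Real.log (4 / δ) * M ^ 2 / 2 * V)) / (M ^ 2 * V) = - Real.log (4 / δ) := by
      field_simp
    rw [this, Real.exp_neg, Real.exp_log (by positivity), inv_div]
  rw [hexp] at key
  have hone : (1 : ENNReal) ≤ (Measure.pi fun p : (i : Fin N) × Fin (m i) => D p.1) A' +
      (Measure.pi fun p : (i : Fin N) × Fin (m i) => D p.1) A'ᶜ := by
    refine le_trans (le_of_eq ?_) (measure_union_le A' A'ᶜ)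
    rw [Set.union_compl_self, measure_univ]
  have h3 : 3 * ENNReal.ofReal (δ / 4) ≤ ENNReal.ofReal δ := by
    rw [show (3 : ENNReal) = ENNReal.ofReal 3 by simp, ← ENNReal.ofReal_mul (by norm_num)]
    exact ENNReal.ofReal_le_ofReal (by linarith)
  rw [ENNReal.ofReal_sub _ hδ.le, ENNReal.ofReal_one, tsub_le_iff_right]
  exact hone.trans (add_le_add le_rfl (key.trans h3))

end
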